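/- Let p : 2^{[3]} → ℝ be a probability distribution on subsets of {1,2,3} (all p_I ≥ 0, ∑_I p_I = 1), with moments μ_I = ∑_{J ⊇ I} p_J and third cumulant k_{123} = μ_{123} − μ_1μ_{23} − μ_2μ_{13} − μ_3μ_{12} + 2μ_1μ_2μ_3. Then |k_{123}| ≤ 1/8, and this bound is sharp: the supremum of |k_{123}| over all probability distributions on 2^{[3]} equals 1/8 and is attained. Thus 𝐤*_3 = 1/8. -/

import Mathlib

open Finset

/-- The moments `μ_I = ∑_{J ⊇ I} p_J` of a real table `p` on subsets of `[3]`. -/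
noncomputable def moment3 (p : Finset (Fin 3) → ℝ) (I : Finset (Fin 3)) : ℝ :=
  ∑ J ∈ univ.filter (fun J => I ⊆ J), p J

/-- The third cumulant
`k_{123} = μ_{123} − μ_1 μ_{23} − μ_2 μ_{13} − μ_3 μ_{12} + 2 μ_1 μ_2 μ_3`. -/
noncomputable def k123 (p : Finset (Fin 3) → ℝ) : ℝ :=
  moment3 p univ - moment3 p {0} * moment3 p {1, 2}
    - moment3 p {1} * moment3 p {0, 2} - moment3 p {2} * moment3 p {0, 1}
    + 2 * moment3 p {0} * moment3 p {1} * moment3 p {2}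

/-- For sign variables with means `β`, `γ` and covariance `D`, the product of the centred variables
has variance `(1 - β²)(1 - γ²) + 4βγD - D²`; this is at most `1`. -/
lemma variance_centered_signs_le_one {β γ D : ℝ}
    (h₁ : 2 * D ≤ 2 - β ^ 2 - γ ^ 2) (h₂ : -(2 * D) ≤ 2 - β ^ 2 - γ ^ 2) :
    (1 - β ^ 2) * (1 - γ ^ 2) + 4 * (β * γ) * D - D ^ 2 ≤ 1 := by
  have key : ∀ b D : ℝ, 0 ≤ b → D ≤ 1 - b → 4 * b * D ≤ 2 * b - b ^ 2 + D ^ 2 := by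
    intro b D hb hD
    rcases le_total b (2 / 5) with h | h
    · nlinarith [sq_nonneg (D - 2 * b), mul_nonneg hb (sub_nonneg.2 h)]
    · nlinarith [sq_nonneg (1 - 2 * b),
        mul_nonneg (sub_nonneg.2 hD) (show 0 ≤ (2 * b - D) + (3 * b - 1) by linarith)]
  rcases le_total 0 (β * γ) with h | h
  · have := key (β * γ) D h (by nlinarith [sq_nonneg (β - γ)])
    nlinarith [sq_nonneg (β - γ)]
  · have := key (-(β * γ)) (-D) (by linarith) (by nlinarith [sq_nonneg (β + γ)])
    nlinarith [sq_nonneg (β + γ)]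

/-- The bound on the third cumulant in terms of the moments of three binary variables; the
hypotheses say that the eight atoms have nonnegative mass. -/
lemma abs_third_cumulant_le {x y z u v w t : ℝ}
    (h₁₂₃ : 0 ≤ t) (h₁₂ : 0 ≤ u - t) (h₁₃ : 0 ≤ v - t) (h₂₃ : 0 ≤ w - t)
    (h₁ : 0 ≤ x - u - v + t) (h₂ : 0 ≤ y - u - w + t) (h₃ : 0 ≤ z - v - w + t)
    (h₀ : 0 ≤ 1 - x - y - z + u + v + w - t) :
    |t - x * w - y * v - z * u + 2 * x * y * z| ≤ 1 / 8 := by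
  have expect_sq : ∀ f : ℝ → ℝ → ℝ → ℝ,
      0 ≤ t * f 1 1 1 ^ 2 + (u - t) * f 1 1 0 ^ 2 + (v - t) * f 1 0 1 ^ 2
        + (w - t) * f 0 1 1 ^ 2 + (x - u - v + t) * f 1 0 0 ^ 2
        + (y - u - w + t) * f 0 1 0 ^ 2 + (z - v - w + t) * f 0 0 1 ^ 2
        + (1 - x - y - z + u + v + w - t) * f 0 0 0 ^ 2 := fun f => by positivity
  have hvar := variance_centered_signs_le_one (β := 2 * y - 1) (γ := 2 * z - 1)
    (D := 4 * (w - y * z))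
    (by linarith [expect_sq fun _ Y Z => (Y - y) - (Z - z)])
    (by linarith [expect_sq fun _ Y Z => (Y - y) + (Z - z)])
  have hx := sq_nonneg (2 * x - 1)
  rw [abs_le]
  constructor
  · linarith [expect_sq fun X Y Z => (X - x) / 2 + ((Y - y) * (Z - z) - (w - y * z))]
  · linarith [expect_sq fun X Y Z => (X - x) / 2 - ((Y - y) * (Z - z) - (w - y * z))]

lemma sum_finset_fin_three (f : Finset (Fin 3) → ℝ) :
    ∑ I, f I = f ∅ + f {0} + f {1} + f {2} + f {0, 1} + f {0, 2} + f {1, 2} + f univ := by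
  have h : (univ : Finset (Finset (Fin 3))) =
      {∅, {0}, {1}, {2}, {0, 1}, {0, 2}, {1, 2}, univ} := by decide
  rw [h]
  repeat rw [sum_insert (by decide)]
  rw [sum_singleton]
  ring

lemma moment3_eq (p : Finset (Fin 3) → ℝ) (I : Finset (Fin 3)) :
    moment3 p I = ∑ J, if I ⊆ J then p J else 0 :=
  sum_filter _ _

lemma moment3_univ (p : Finset (Fin 3) → ℝ) : moment3 p univ = p univ := by
  simp [moment3, univ_subset_iff, filter_eq']

lemma moment3_pair (p : Finset (Fin 3) → ℝ) :
    moment3 p {0, 1} = p {0, 1} + p univ ∧ moment3 p {0, 2} = p {0, 2} + p univ ∧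
      moment3 p {1, 2} = p {1, 2} + p univ := by
  refine ⟨?_, ?_, ?_⟩ <;> rw [moment3_eq, sum_finset_fin_three] <;> simp +decide

lemma moment3_singleton (p : Finset (Fin 3) → ℝ) :
    moment3 p {0} = p {0} + p {0, 1} + p {0, 2} + p univ ∧
      moment3 p {1} = p {1} + p {0, 1} + p {1, 2} + p univ ∧
      moment3 p {2} = p {2} + p {0, 2} + p {1, 2} + p univ := by
  refine ⟨?_, ?_, ?_⟩ <;> rw [moment3_eq, sum_finset_fin_three] <;> simp +decide

lemma abs_k123_le (p : Finset (Fin 3) → ℝ) (hp : ∀ I, 0 ≤ p I) (hsum : ∑ I, p I = 1) :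
    |k123 p| ≤ 1 / 8 := by
  rw [sum_finset_fin_three] at hsum
  obtain ⟨h₀₁, h₀₂, h₁₂⟩ := moment3_pair p
  obtain ⟨h₀, h₁, h₂⟩ := moment3_singleton p
  have hu := moment3_univ p
  apply abs_third_cumulant_le
  · linarith [hp univ]
  · linarith [hp {0, 1}]
  · linarith [hp {0, 2}]
  · linarith [hp {1, 2}]
  · linarith [hp {0}]
  · linarith [hp {1}]
  · linarith [hp {2}]
  · linarith [hp ∅]

/-- The uniform distribution on the subsets of odd cardinality attains the bound. -/
lemma exists_k123_eq : ∃ p : Finset (Fin 3) → ℝ,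
    (∀ I, 0 ≤ p I) ∧ ∑ I, p I = 1 ∧ 1 / 8 = |k123 p| := by
  refine ⟨fun I => if Odd #I then 1 / 4 else 0, fun I => by positivity, ?_, ?_⟩
  · rw [sum_finset_fin_three]
    simp +decide
    norm_num
  · obtain ⟨h₀₁, h₀₂, h₁₂⟩ := moment3_pair fun I => if Odd #I then 1 / 4 else 0
    obtain ⟨h₀, h₁, h₂⟩ := moment3_singleton fun I => if Odd #I then 1 / 4 else 0
    rw [k123, h₀₁, h₀₂, h₁₂, h₀, h₁, h₂, moment3_univ]
    simp +decide
    norm_num [abs_of_pos]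

/-- for every probability distribution on subsets of `{1,2,3}` the
third cumulant satisfies `|k_{123}| ≤ 1/8`, the bound is sharp and attained; thus
`𝐤*₃ = 1/8`. -/
theorem third_cumulant_bound :
    (∀ p : Finset (Fin 3) → ℝ,
      (∀ I : Finset (Fin 3), 0 ≤ p I) → (∑ I : Finset (Fin 3), p I = 1) →
        |k123 p| ≤ 1 / 8) ∧
    IsGreatest {x : ℝ | ∃ p : Finset (Fin 3) → ℝ,
      (∀ I : Finset (Fin 3), 0 ≤ p I) ∧ (∑ I : Finset (Fin 3), p I = 1) ∧
      x = |k123 p|} (1 / 8) := by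
  exact ⟨abs_k123_le, exists_k123_eq, fun _ ⟨p, hp, hsum, hx⟩ => hx ▸ abs_k123_le p hp hsum⟩
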